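/- arXiv:math-ph/0306033 — 4 statements merged into one kernel-verified Lean document; each statement's English description precedes it below -/
import Mathlib

section
/- Let α > 0 and κ > 0, and let (Y_n) be a sequence of nonempty finite subsets of ℝ² with |Y_n| → ∞ as n → ∞, satisfying sup_n (1/|Y_n|) · sup_{x ∈ Y_n} Σ_{y ∈ Y_n, y ≠ x} (1/2π) K₀(κ·|x−y|) < α. For each n let Λ_n be the complex |Y_n| × |Y_n| matrix indexed by the points of Y_n with entries Λ_n(x,x) = α + (1/(2π|Y_n|))(log(κ/2) + C_E) on the diagonal and Λ_n(x,y) = −(1/(2π|Y_n|)) K₀(κ·|x−y|) for x ≠ y. Then there exist a constant C > 0 and n₀ ∈ ℕ such that for all n ≥ n₀ the matrix Λ_n is invertible and the ℓ²→ℓ² operator norm of Λ_n⁻¹ is less than C. -/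
open MeasureTheory Real Filter

noncomputable instance : DecidableEq (EuclideanSpace ℝ (Fin 2)) := Classical.decEq _

/-- The modified Bessel function of the second kind of order zero,
`K₀(r) = ∫₀^∞ exp(−r·cosh t) dt`. -/
noncomputable def besselK0 (r : ℝ) : ℝ := ∫ t in Set.Ioi (0 : ℝ), Real.exp (-r * Real.cosh t)

/-- The ℓ²→ℓ² operator norm of a finite square complex matrix. -/
noncomputable def l2OpNorm {ι : Type*} [Fintype ι] [DecidableEq ι] (A : Matrix ι ι ℂ) : ℝ :=
  ‖(Matrix.toEuclideanCLM (𝕜 := ℂ) A : EuclideanSpace ℂ ι →L[ℂ] EuclideanSpace ℂ ι)‖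

/-- The matrix `Λ_n` of Lemma 2.3: diagonal entries `α + (1/(2π|Y|))(log(κ/2) + C_E)`,
off-diagonal entries `−(1/(2π|Y|)) K₀(κ·|x−y|)`. -/
noncomputable def LambdaMatrix (α κ : ℝ) (Y : Finset (EuclideanSpace ℝ (Fin 2))) :
    Matrix Y Y ℂ := fun x y =>
  if x = y then
    (α : ℂ) + (1 / (2 * Real.pi * Y.card) : ℝ) * ((Real.log (κ / 2) : ℂ) +
      (Real.eulerMascheroniConstant : ℂ))
  else
    -((1 / (2 * Real.pi * Y.card) * besselK0 (κ * dist (x : EuclideanSpace ℝ (Fin 2)) y) : ℝ) : ℂ)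

lemma besselK0_nonneg' (r : ℝ) : 0 ≤ besselK0 r :=
  integral_nonneg fun _ => (Real.exp_pos _).le

lemma schur_aux {ι : Type*} [Fintype ι] (k : ι → ι → ℝ) (b : ℝ)
    (hk : ∀ i j, 0 ≤ k i j) (hs : ∀ i j, k i j = k j i) (hb0 : 0 ≤ b)
    (hb : ∀ i, ∑ j, k i j ≤ b) (v : EuclideanSpace ℂ ι) :
    ‖(WithLp.toLp 2 (fun i => ∑ j, (k i j : ℂ) * v j) : EuclideanSpace ℂ ι)‖ ≤ b * ‖v‖ := by
  refine (abs_le_of_sq_le_sq' ?_ (by positivity)).2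
  rw [mul_pow, EuclideanSpace.norm_sq_eq, EuclideanSpace.norm_sq_eq]
  have h1 : ∀ i, ‖∑ j, (k i j : ℂ) * v j‖ ^ 2 ≤ b * ∑ j, k i j * ‖v j‖ ^ 2 := by
    intro i
    have e1 : ‖∑ j, (k i j : ℂ) * v j‖ ≤ ∑ j, k i j * ‖v j‖ := by
      refine (norm_sum_le _ _).trans (le_of_eq ?_)
      refine Finset.sum_congr rfl fun j _ => ?_
      rw [norm_mul, Complex.norm_real, Real.norm_of_nonneg (hk i j)]
    have e2 : (∑ j, k i j * ‖v j‖) ^ 2 ≤ (∑ j, k i j) * ∑ j, k i j * ‖v j‖ ^ 2 := by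
      refine Finset.sum_sq_le_sum_mul_sum_of_sq_eq_mul _ (fun j _ => hk i j)
        (fun j _ => mul_nonneg (hk i j) (sq_nonneg _)) (fun j _ => by ring)
    calc _ ≤ (∑ j, k i j * ‖v j‖) ^ 2 := by gcongr
      _ ≤ _ := e2
      _ ≤ _ := mul_le_mul_of_nonneg_right (hb i)
        (Finset.sum_nonneg fun j _ => mul_nonneg (hk i j) (sq_nonneg _))
  calc _ ≤ ∑ i, b * ∑ j, k i j * ‖v j‖ ^ 2 := Finset.sum_le_sum fun i _ => h1 i
    _ = b * ∑ j, (∑ i, k j i) * ‖v j‖ ^ 2 := by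
      rw [← Finset.mul_sum, Finset.sum_comm]
      congr 1
      refine Finset.sum_congr rfl fun j _ => ?_
      rw [Finset.sum_mul]
      exact Finset.sum_congr rfl fun i _ => by rw [hs]
    _ ≤ b * ∑ j, b * ‖v j‖ ^ 2 := by
      gcongr with j
      exact hb j
    _ = _ := by rw [← Finset.mul_sum]; ring

lemma inv_aux {ι : Type*} [Fintype ι] [DecidableEq ι] (A : Matrix ι ι ℂ) (c : ℝ) (hc : 0 < c)
    (h : ∀ v : EuclideanSpace ℂ ι, c * ‖v‖ ≤ ‖Matrix.toEuclideanCLM (𝕜 := ℂ) A v‖) :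
    IsUnit A ∧ l2OpNorm A⁻¹ ≤ c⁻¹ := by
  have hu : IsUnit A := by
    rw [← Matrix.mulVec_injective_iff_isUnit]
    intro x y hxy
    have h2 := h (WithLp.toLp 2 (x - y))
    have h3 : Matrix.toEuclideanCLM (𝕜 := ℂ) A (WithLp.toLp 2 (x - y)) = 0 := by
      rw [Matrix.toEuclideanCLM_toLp, Matrix.mulVec_sub, sub_eq_zero.mpr hxy]; rfl
    rw [h3, norm_zero] at h2
    have h4 : ‖(WithLp.toLp 2 (x - y) : EuclideanSpace ℂ ι)‖ = 0 :=
      le_antisymm (by nlinarith) (norm_nonneg _)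
    rw [norm_eq_zero] at h4
    have := congrArg WithLp.ofLp h4
    exact sub_eq_zero.mp this
  refine ⟨hu, ?_⟩
  refine ContinuousLinearMap.opNorm_le_bound _ (by positivity) fun w => ?_
  have h5 := h (Matrix.toEuclideanCLM (𝕜 := ℂ) A⁻¹ w)
  rw [← ContinuousLinearMap.mul_apply, ← map_mul, Matrix.mul_nonsing_inv _
    ((Matrix.isUnit_iff_isUnit_det _).mp hu), map_one, ContinuousLinearMap.one_apply] at h5
  rw [inv_mul_eq_div, le_div_iff₀ hc]
  linarith

/-- if `α, κ > 0`, the finite sets `Y n` are nonempty with `|Y n| → ∞`, and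
`sup_n (1/|Y_n|) sup_{x ∈ Y_n} Σ_{y ∈ Y_n \ {x}} (1/2π) K₀(κ|x−y|) < α`, then eventually the
matrices `Λ_n` are invertible with ℓ²→ℓ² norms of the inverses uniformly bounded. -/
theorem lambda_matrix_eventually_invertible
    (α κ : ℝ) (hα : 0 < α) (hκ : 0 < κ)
    (Y : ℕ → Finset (EuclideanSpace ℝ (Fin 2)))
    (hne : ∀ n, (Y n).Nonempty)
    (hcard : Tendsto (fun n => (Y n).card) atTop atTop)
    (hsup : ∃ b < α, ∀ n, ∀ x ∈ Y n,
      (1 / ((Y n).card : ℝ)) * ∑ y ∈ (Y n).erase x, (1 / (2 * Real.pi)) * besselK0 (κ * dist x y)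
        ≤ b) :
    ∃ C > 0, ∃ n₀ : ℕ, ∀ n ≥ n₀,
      IsUnit (LambdaMatrix α κ (Y n)) ∧ l2OpNorm (LambdaMatrix α κ (Y n))⁻¹ < C := by
  obtain ⟨b, hb, hsup⟩ := hsup
  set L : ℝ := Real.log (κ / 2) + Real.eulerMascheroniConstant with hL
  have hc : 0 < (α - b) / 2 := by linarith
  have hlim : Tendsto (fun n => 1 / (2 * Real.pi * ((Y n).card : ℝ)) * L) atTop (nhds 0) := by
    have h1 : Tendsto (fun n => ((Y n).card : ℝ)) atTop atTop :=
      tendsto_natCast_atTop_atTop.comp hcard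
    have h2 := ((h1.const_mul_atTop Real.two_pi_pos).inv_tendsto_atTop).mul_const L
    simpa [one_div] using h2
  have hev := hlim.eventually (lt_mem_nhds (show -((α - b) / 2) < 0 by linarith))
  obtain ⟨n₀, hn₀⟩ := eventually_atTop.mp hev
  refine ⟨((α - b) / 2)⁻¹ + 1, by positivity, n₀, fun n hn => ?_⟩
  have hd := hn₀ n hn
  suffices H : IsUnit (LambdaMatrix α κ (Y n)) ∧
      l2OpNorm (LambdaMatrix α κ (Y n))⁻¹ ≤ ((α - b) / 2)⁻¹ from ⟨H.1, by linarith [H.2]⟩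
  refine inv_aux _ _ hc fun v => ?_
  set d : ℝ := α + 1 / (2 * Real.pi * ((Y n).card : ℝ)) * L with hdd
  let k : Y n → Y n → ℝ := fun x y => if x = y then 0 else
    1 / (2 * Real.pi * (Y n).card) * besselK0 (κ * dist (x : EuclideanSpace ℝ (Fin 2)) y)
  have hk : ∀ i j, 0 ≤ k i j := by
    intro i j
    simp only [k]
    split_ifs
    · exact le_rfl
    · exact mul_nonneg (by positivity) (besselK0_nonneg' _)
  have hs : ∀ i j, k i j = k j i := by
    intro i j
    simp only [k, eq_comm (a := i), dist_comm (i : EuclideanSpace ℝ (Fin 2))]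
  have hrow : ∀ i, ∑ j, k i j ≤ b := by
    intro i
    refine le_trans (le_of_eq ?_) (hsup n i i.2)
    rw [Finset.mul_sum]
    have e : ∑ j, k i j = ∑ y ∈ Y n, if (i : EuclideanSpace ℝ (Fin 2)) = y then 0 else
        1 / (2 * Real.pi * (Y n).card) * besselK0 (κ * dist (i : EuclideanSpace ℝ (Fin 2)) y) := by
      rw [← Finset.sum_coe_sort (Y n)]
      refine Finset.sum_congr rfl fun j _ => ?_
      simp only [k, Subtype.ext_iff]
    rw [e, ← Finset.sum_erase (a := (i : EuclideanSpace ℝ (Fin 2))) _ (by simp)]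
    refine Finset.sum_congr rfl fun j hj => ?_
    rw [if_neg (Finset.ne_of_mem_erase hj).symm]
    rw [← mul_assoc, one_div_mul_one_div, mul_comm ((Y n).card : ℝ)]
  have hb0 : 0 ≤ b := by
    obtain ⟨x, hx⟩ := hne n
    exact (Finset.sum_nonneg fun j _ => hk ⟨x, hx⟩ j).trans (hrow ⟨x, hx⟩)
  have key := schur_aux k b hk hs hb0 hrow v
  have hA : Matrix.toEuclideanCLM (𝕜 := ℂ) (LambdaMatrix α κ (Y n)) v =
      (d : ℂ) • v - WithLp.toLp 2 (fun i => ∑ j, (k i j : ℂ) * v j) := by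
    ext i
    have e0 : (Matrix.toEuclideanCLM (𝕜 := ℂ) (LambdaMatrix α κ (Y n)) v) i =
      ∑ j, LambdaMatrix α κ (Y n) i j * v j := rfl
    rw [e0]
    have e1 : ∀ j, LambdaMatrix α κ (Y n) i j * v j =
        (if i = j then (d : ℂ) * v j else 0) - (k i j : ℂ) * v j := by
      intro j
      simp only [LambdaMatrix, k]
      split_ifs
      · simp [hdd, hL]
      · push_cast; ring
    simp only [e1, Finset.sum_sub_distrib, Finset.sum_ite_eq, Finset.mem_univ, if_true]
    simp
  rw [hA]
  have hdpos : 0 ≤ d := by linarith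
  have t := norm_sub_norm_le ((d : ℂ) • v) (WithLp.toLp 2 (fun i => ∑ j, (k i j : ℂ) * v j))
  rw [norm_smul, Complex.norm_real, Real.norm_of_nonneg hdpos] at t
  have : ((α - b) / 2) * ‖v‖ ≤ (d - b) * ‖v‖ := by
    gcongr; linarith
  linarith
end

section
/- Let γ > 0. For every a > γ²/4 there exists ℓ₀ > 0 such that for all ℓ ≥ ℓ₀ and every continuously differentiable function u : [−ℓ, ℓ] → ℝ one has γ·u(0)² ≤ ∫_{−ℓ}^{ℓ} u'(x)² dx + a·∫_{−ℓ}^{ℓ} u(x)² dx. (Equivalently, the lowest Neumann eigenvalue ε(ℓ) of −d²/dy² − γδ(y) on L²([−ℓ,ℓ]) satisfies: for any η < −γ²/4 there is ℓ with ε(ℓ) > η.) -/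
open MeasureTheory

theorem riccati_aux (p q c d a : ℝ) (hpq : p ≤ q) (u v : ℝ → ℝ)
    (hu : ContinuousOn u (Set.Icc p q)) (hv : ContinuousOn v (Set.Icc p q))
    (hd : ∀ x ∈ Set.Ioo p q, HasDerivAt u (v x) x)
    (hb : ∀ x ∈ Set.Icc p q, (c + d * x) ^ 2 - d ≤ a) :
    (c + d * p) * u p ^ 2 - (c + d * q) * u q ^ 2 ≤
      (∫ x in p..q, v x ^ 2) + a * ∫ x in p..q, u x ^ 2 := by
  have hφ : ContinuousOn (fun x : ℝ => c + d * x) (Set.Icc p q) := by fun_prop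
  have hF : ContinuousOn (fun x => (c + d * x) * u x ^ 2) (Set.Icc p q) := hφ.mul (hu.pow 2)
  have hF' : ContinuousOn (fun x => d * u x ^ 2 + (c + d * x) * (2 * u x * v x))
      (Set.Icc p q) :=
    (continuousOn_const.mul (hu.pow 2)).add (hφ.mul ((continuousOn_const.mul hu).mul hv))
  have ii : ∀ {f : ℝ → ℝ}, ContinuousOn f (Set.Icc p q) → IntervalIntegrable f volume p q :=
    fun hf => ContinuousOn.intervalIntegrable (by rwa [Set.uIcc_of_le hpq])
  have h1 := intervalIntegral.integral_eq_sub_of_hasDerivAt_of_le hpq hF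
    (f' := fun x => d * u x ^ 2 + (c + d * x) * (2 * u x * v x)) (by
      intro x hx
      have h := (((hasDerivAt_id x).const_mul d).const_add c).mul ((hd x hx).pow 2)
      refine h.congr_deriv ?_
      simp) (ii hF')
  have hv2 : IntervalIntegrable (fun x => v x ^ 2) volume p q := ii (hv.pow 2)
  have hu2 : IntervalIntegrable (fun x => u x ^ 2) volume p q := ii (hu.pow 2)
  have h2 : (∫ x in p..q, -(d * u x ^ 2 + (c + d * x) * (2 * u x * v x))) ≤
      ∫ x in p..q, (v x ^ 2 + a * u x ^ 2) := by
    apply intervalIntegral.integral_mono_on hpq (ii hF').neg (hv2.add (hu2.const_mul a))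
    intro x hx
    show -(d * u x ^ 2 + (c + d * x) * (2 * u x * v x)) ≤ v x ^ 2 + a * u x ^ 2
    have := mul_le_mul_of_nonneg_right (hb x hx) (sq_nonneg (u x))
    nlinarith [sq_nonneg (v x + (c + d * x) * u x)]
  rw [intervalIntegral.integral_neg, h1, intervalIntegral.integral_add hv2 (hu2.const_mul a),
    intervalIntegral.integral_const_mul] at h2
  linarith

/-- for `γ > 0` and any `a > γ²/4` there is `ℓ₀ > 0` such that for all `ℓ ≥ ℓ₀`
and every continuously differentiable `u : [−ℓ, ℓ] → ℝ`,
`γ·u(0)² ≤ ∫_{−ℓ}^{ℓ} u'² + a·∫_{−ℓ}^{ℓ} u²`; equivalently, the lowest Neumann eigenvalue of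
`−d²/dy² − γδ(y)` on `[−ℓ,ℓ]` eventually exceeds any `η < −γ²/4`. -/
theorem neumann_delta_form_lower_bound
    (γ : ℝ) (hγ : 0 < γ) (a : ℝ) (ha : γ ^ 2 / 4 < a) :
    ∃ ℓ₀ > 0, ∀ ℓ ≥ ℓ₀, ∀ u : ℝ → ℝ,
      ContDiffOn ℝ 1 u (Set.Icc (-ℓ) ℓ) →
      γ * u 0 ^ 2 ≤ (∫ x in Set.Icc (-ℓ) ℓ, derivWithin u (Set.Icc (-ℓ) ℓ) x ^ 2) +
        a * ∫ x in Set.Icc (-ℓ) ℓ, u x ^ 2 := by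
  have hδ : 0 < a - γ ^ 2 / 4 := by linarith
  refine ⟨γ / (2 * (a - γ ^ 2 / 4)), by positivity, ?_⟩
  intro ℓ hℓ u hu
  have hℓ0 : 0 < ℓ := lt_of_lt_of_le (by positivity) hℓ
  have hk : γ / (2 * ℓ) ≤ a - γ ^ 2 / 4 := by
    rw [ge_iff_le, div_le_iff₀ (by positivity)] at hℓ
    rw [div_le_iff₀ (by positivity)]
    linarith
  obtain ⟨k, hkd⟩ : ∃ k, k = γ / (2 * ℓ) := ⟨_, rfl⟩
  have hkl : k * ℓ = γ / 2 := by rw [hkd]; field_simp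
  have hk0 : 0 < k := by rw [hkd]; positivity
  rw [← hkd] at hk
  have huc := hu.continuousOn
  have hvc : ContinuousOn (derivWithin u (Set.Icc (-ℓ) ℓ)) (Set.Icc (-ℓ) ℓ) :=
    hu.continuousOn_derivWithin (uniqueDiffOn_Icc (by linarith)) le_rfl
  have hd : ∀ x ∈ Set.Ioo (-ℓ) ℓ, HasDerivAt u (derivWithin u (Set.Icc (-ℓ) ℓ) x) x := by
    intro x hx
    exact ((hu.differentiableOn one_ne_zero) x
      (Set.Ioo_subset_Icc_self hx)).hasDerivWithinAt.hasDerivAt (Icc_mem_nhds hx.1 hx.2)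
  generalize derivWithin u (Set.Icc (-ℓ) ℓ) = v at *
  have s1 : Set.Icc (-ℓ) 0 ⊆ Set.Icc (-ℓ) ℓ := Set.Icc_subset_Icc_right hℓ0.le
  have s2 : Set.Icc 0 ℓ ⊆ Set.Icc (-ℓ) ℓ := Set.Icc_subset_Icc_left (by linarith)
  have hL := riccati_aux (-ℓ) 0 (-(γ / 2)) (-k) a (by linarith) u v (huc.mono s1) (hvc.mono s1)
    (fun x hx => hd x ⟨hx.1, by linarith [hx.2]⟩) (by
      intro x hx
      have h0 : 0 ≤ γ / 2 + k * x := by nlinarith [hx.1]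
      have h1 : γ / 2 + k * x ≤ γ / 2 := by nlinarith [hx.2]
      nlinarith)
  have hR := riccati_aux 0 ℓ (γ / 2) (-k) a hℓ0.le u v (huc.mono s2) (hvc.mono s2)
    (fun x hx => hd x ⟨by linarith [hx.1], hx.2⟩) (by
      intro x hx
      have h0 : 0 ≤ γ / 2 - k * x := by nlinarith [hx.2]
      have h1 : γ / 2 - k * x ≤ γ / 2 := by nlinarith [hx.1]
      nlinarith)
  have split : ∀ f : ℝ → ℝ, ContinuousOn f (Set.Icc (-ℓ) ℓ) →
      ∫ x in Set.Icc (-ℓ) ℓ, f x = (∫ x in (-ℓ)..0, f x) + ∫ x in (0 : ℝ)..ℓ, f x := by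
    intro f hf
    rw [integral_Icc_eq_integral_Ioc, ← intervalIntegral.integral_of_le (by linarith),
      intervalIntegral.integral_add_adjacent_intervals]
    · exact ContinuousOn.intervalIntegrable (by
        rw [Set.uIcc_of_le (by linarith)]; exact hf.mono s1)
    · exact ContinuousOn.intervalIntegrable (by
        rw [Set.uIcc_of_le hℓ0.le]; exact hf.mono s2)
  rw [split (fun x => v x ^ 2) (hvc.pow 2), split (fun x => u x ^ 2) (huc.pow 2)]
  have e1 : -(γ / 2) + -k * -ℓ = 0 := by linarith
  have e2 : γ / 2 + -k * ℓ = 0 := by linarith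
  rw [e1] at hL
  rw [e2] at hR
  simp only [mul_zero, add_zero, zero_mul] at hL hR
  linarith
end

section
/- Let γ > 0, β ∈ (0, π), L > 0, and d = L·tan(β/2). Let g(y) = 1 for |y| ≤ 2d, g(y) = exp(−γ(|y|−2d)) for |y| > 2d, with a.e. derivative h(y) = −γ·sign(y)·exp(−γ(|y|−2d)) for |y| > 2d and h = 0 on (−2d, 2d). Let f : [L, 2L] → ℝ be continuously differentiable, not identically zero, with f(L) = f(2L) = 0, and let F : ℝ → ℝ be its extension by zero. Set Φ(x,y) = F(x)·g(y). Then the two arc-length integrals over the halflines at angles ±β/2 satisfy ∫₀^∞ |Φ(s·cos(β/2), s·sin(β/2))|² ds + ∫₀^∞ |Φ(s·cos(β/2), −s·sin(β/2))|² ds = 2·sec(β/2)·∫_L^{2L} f(x)² dx, and the shifted energy form q[Φ] := ∫_{ℝ²} (F'(x)²g(y)² + F(x)²h(y)²) dx dy − 2γ·sec(β/2)·∫_L^{2L} f(x)² dx + (γ²/4)·∫_{ℝ²} F(x)²g(y)² dx dy is strictly negative if and only if ∫_L^{2L} f'(x)² dx / ∫_L^{2L} f(x)² dx < γ²·(2·sec(β/2)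 − γd − 5/4)/(1 + 4γd). -/
open MeasureTheory Real

/-- The transverse profile `g`: equal to `1` on `[−2d, 2d]` and to `exp(−γ(|y|−2d))` outside. -/
noncomputable def transProfile (γ d : ℝ) (y : ℝ) : ℝ :=
  if |y| ≤ 2 * d then 1 else Real.exp (-γ * (|y| - 2 * d))

/-- The a.e. derivative `h` of the transverse profile. -/
noncomputable def transProfileDeriv (γ d : ℝ) (y : ℝ) : ℝ :=
  if |y| ≤ 2 * d then 0 else -γ * Real.sign y * Real.exp (-γ * (|y| - 2 * d))

theorem aux_phi (γ d : ℝ) (hγ : 0 < γ) :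
    Integrable ((Set.Ioi (2 * d)).indicator (fun y => Real.exp (-γ * (y - 2 * d)) ^ 2)) ∧
    ∫ y, (Set.Ioi (2 * d)).indicator (fun y => Real.exp (-γ * (y - 2 * d)) ^ 2) y
      = 1 / (2 * γ) := by
  have e : (fun y => Real.exp (-γ * (y - 2 * d)) ^ 2) =
      fun y => Real.exp (4 * γ * d) * Real.exp ((-(2 * γ)) * y) := by
    funext y
    rw [← Real.exp_nat_mul, ← Real.exp_add]
    congr 1
    push_cast
    ring
  rw [integrable_indicator_iff measurableSet_Ioi, integral_indicator measurableSet_Ioi, e]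
  refine ⟨(integrableOn_exp_mul_Ioi (by linarith) _).const_mul _, ?_⟩
  rw [integral_const_mul, integral_exp_mul_Ioi (by linarith)]
  have : Real.exp (4 * γ * d) * Real.exp ((-(2 * γ)) * (2 * d)) = 1 := by
    rw [← Real.exp_add, ← Real.exp_zero]
    congr 1
    ring
  rw [neg_div_neg_eq, ← mul_div_assoc, this]

theorem aux_gh (γ d : ℝ) (hγ : 0 < γ) (hd : 0 < d) :
    Integrable (fun y => transProfile γ d y ^ 2) ∧
    Integrable (fun y => transProfileDeriv γ d y ^ 2) ∧
    (∫ y, transProfile γ d y ^ 2 = 4 * d + 1 / γ) ∧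
    (∫ y, transProfileDeriv γ d y ^ 2 = γ) := by
  obtain ⟨hi, hv⟩ := aux_phi γ d hγ
  set φ := (Set.Ioi (2 * d)).indicator (fun y => Real.exp (-γ * (y - 2 * d)) ^ 2) with hφ
  have hi2 := hi.comp_neg
  have hv2 : ∫ y, φ (-y) = 1 / (2 * γ) := by rw [integral_neg_eq_self, hv]
  have hone : Integrable ((Set.Icc (-(2 * d)) (2 * d)).indicator (fun _ => (1 : ℝ))) := by
    rw [integrable_indicator_iff measurableSet_Icc]
    exact integrableOn_const (by simp)
  have hg : (fun y => transProfile γ d y ^ 2) = fun y =>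
      (Set.Icc (-(2 * d)) (2 * d)).indicator (fun _ => (1 : ℝ)) y + (φ y + φ (-y)) := by
    funext y
    by_cases h : |y| ≤ 2 * d
    · have h' := abs_le.1 h
      have h1 : ¬ (2 * d < y) := by linarith
      have h2 : ¬ (2 * d < -y) := by linarith
      simp [transProfile, hφ, Set.indicator, h, h'.1, h'.2, h1, h2]
    · have h3 : ¬ (-(2 * d) ≤ y ∧ y ≤ 2 * d) := fun h' => h (abs_le.2 h')
      rcases lt_abs.1 (not_le.1 h) with h1 | h1
      · have h2 : ¬ (2 * d < -y) := by linarith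
        have h4 : |y| = y := abs_of_pos (by linarith)
        simp only [transProfile, hφ, Set.indicator, h, Set.mem_Icc, Set.mem_Ioi, h1, h2, h3,
          if_true, if_false, h4]
        simp [not_le.2 h1]
      · have h2 : ¬ (2 * d < y) := by linarith
        have h4 : |y| = -y := abs_of_neg (by linarith)
        simp only [transProfile, hφ, Set.indicator, h, Set.mem_Icc, Set.mem_Ioi, h1, h2, h3,
          if_true, if_false, h4]
        simp [not_le.2 h1]
  have hh : (fun y => transProfileDeriv γ d y ^ 2) = fun y => γ ^ 2 * (φ y + φ (-y)) := by
    funext y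
    by_cases h : |y| ≤ 2 * d
    · have h' := abs_le.1 h
      have h1 : ¬ (2 * d < y) := by linarith
      have h2 : ¬ (2 * d < -y) := by linarith
      simp [transProfileDeriv, hφ, Set.indicator, h, h1, h2]
    · rcases lt_abs.1 (not_le.1 h) with h1 | h1
      · have h2 : ¬ (2 * d < -y) := by linarith
        have h4 : |y| = y := abs_of_pos (by linarith)
        have h5 : Real.sign y = 1 := Real.sign_of_pos (by linarith)
        simp only [transProfileDeriv, hφ, Set.indicator, Set.mem_Ioi, h1, h2,
          if_true, if_false, h4, h5, not_le.2 h1]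
        ring
      · have h2 : ¬ (2 * d < y) := by linarith
        have h4 : |y| = -y := abs_of_neg (by linarith)
        have h5 : Real.sign y = -1 := Real.sign_of_neg (by linarith)
        simp only [transProfileDeriv, hφ, Set.indicator, Set.mem_Ioi, h1, h2,
          if_true, if_false, h4, h5, not_le.2 h1]
        ring
  have hi3 : Integrable (fun y => φ y + φ (-y)) := hi.add hi2
  have hs : ∫ y, (φ y + φ (-y)) = 1 / γ := by
    rw [integral_add hi hi2, hv, hv2]
    field_simp
    norm_num
  rw [hg, hh]
  refine ⟨hone.add (hi.add hi2), (hi.add hi2).const_mul _, ?_, ?_⟩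
  · rw [integral_add hone hi3, hs, integral_indicator measurableSet_Icc]
    simp
    rw [max_eq_left (by linarith)]
    ring
  · rw [integral_const_mul, hs]
    field_simp

/-- with `d = L tan(β/2)`, `F, F'` the extensions by zero of a `C¹` function `f` on
`[L, 2L]` vanishing at the endpoints (not identically zero) and of its derivative `f'`, and
`Φ(x,y) = F(x)g(y)`: the two arc-length integrals along the arms of `Γ(β)` sum to
`2 sec(β/2) ∫ f²`, and the shifted energy form `q[Φ]` is negative iff
`∫ f'²/∫ f² < γ²(2 sec(β/2) − γd − 5/4)/(1 + 4γd)`. -/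
theorem brokenLine_trial_function
    (γ β L : ℝ) (hγ : 0 < γ) (hβ : β ∈ Set.Ioo 0 Real.pi) (hL : 0 < L)
    (d : ℝ) (hd : d = L * Real.tan (β / 2))
    (f f' : ℝ → ℝ)
    (hderiv : ∀ x ∈ Set.Icc L (2 * L), HasDerivWithinAt f (f' x) (Set.Icc L (2 * L)) x)
    (hf'cont : ContinuousOn f' (Set.Icc L (2 * L)))
    (hfL : f L = 0) (hf2L : f (2 * L) = 0)
    (hfne : ∃ x ∈ Set.Icc L (2 * L), f x ≠ 0)
    (F F' : ℝ → ℝ)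
    (hF : F = Set.indicator (Set.Icc L (2 * L)) f)
    (hF' : F' = Set.indicator (Set.Icc L (2 * L)) f')
    (g h : ℝ → ℝ) (hg : g = transProfile γ d) (hh : h = transProfileDeriv γ d)
    (Φ : ℝ → ℝ → ℝ) (hΦ : Φ = fun x y => F x * g y) :
    ((∫ s in Set.Ioi (0 : ℝ), Φ (s * Real.cos (β / 2)) (s * Real.sin (β / 2)) ^ 2) +
       (∫ s in Set.Ioi (0 : ℝ), Φ (s * Real.cos (β / 2)) (-(s * Real.sin (β / 2))) ^ 2) =
      2 * (Real.cos (β / 2))⁻¹ * ∫ x in Set.Icc L (2 * L), f x ^ 2) ∧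
    (((∫ p : ℝ × ℝ, (F' p.1 ^ 2 * g p.2 ^ 2 + F p.1 ^ 2 * h p.2 ^ 2)) -
        2 * γ * (Real.cos (β / 2))⁻¹ * (∫ x in Set.Icc L (2 * L), f x ^ 2) +
        γ ^ 2 / 4 * ∫ p : ℝ × ℝ, F p.1 ^ 2 * g p.2 ^ 2) < 0 ↔
      (∫ x in Set.Icc L (2 * L), f' x ^ 2) / (∫ x in Set.Icc L (2 * L), f x ^ 2) <
        γ ^ 2 * (2 * (Real.cos (β / 2))⁻¹ - γ * d - 5 / 4) / (1 + 4 * γ * d)) := by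
  have hc : 0 < Real.cos (β / 2) := Real.cos_pos_of_mem_Ioo ⟨by linarith [hβ.1, Real.pi_pos], by linarith [hβ.2]⟩
  have hsn : 0 < Real.sin (β / 2) := Real.sin_pos_of_pos_of_lt_pi (by linarith [hβ.1]) (by linarith [hβ.1, hβ.2])
  have htn : d * Real.cos (β / 2) = L * Real.sin (β / 2) := by
    rw [hd, Real.tan_eq_sin_div_cos]
    field_simp
  have hdpos : 0 < d := by
    rw [hd, Real.tan_eq_sin_div_cos]
    positivity
  have hfc : ContinuousOn f (Set.Icc L (2 * L)) := fun x hx => (hderiv x hx).continuousWithinAt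
  have hB : 0 < ∫ x in Set.Icc L (2 * L), f x ^ 2 := by
    rw [integral_Icc_eq_integral_Ioc, ← intervalIntegral.integral_of_le (by linarith)]
    obtain ⟨x, hx, hfx⟩ := hfne
    exact intervalIntegral.integral_pos (by linarith) (hfc.pow 2) (fun x _ => sq_nonneg _)
      ⟨x, hx, by positivity⟩
  have hF2 : (fun x => F x ^ 2) = (Set.Icc L (2 * L)).indicator (fun x => f x ^ 2) := by
    funext x
    by_cases hx : x ∈ Set.Icc L (2 * L) <;> simp [hF, hx]
  have hF'2 : (fun x => F' x ^ 2) = (Set.Icc L (2 * L)).indicator (fun x => f' x ^ 2) := by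
    funext x
    by_cases hx : x ∈ Set.Icc L (2 * L) <;> simp [hF', hx]
  have iF : Integrable (fun x => F x ^ 2) := by
    rw [hF2, integrable_indicator_iff measurableSet_Icc]
    exact (hfc.pow 2).integrableOn_Icc
  have iF' : Integrable (fun x => F' x ^ 2) := by
    rw [hF'2, integrable_indicator_iff measurableSet_Icc]
    exact (hf'cont.pow 2).integrableOn_Icc
  have vF : ∫ x, F x ^ 2 = ∫ x in Set.Icc L (2 * L), f x ^ 2 := by
    rw [hF2, integral_indicator measurableSet_Icc]
  have vF' : ∫ x, F' x ^ 2 = ∫ x in Set.Icc L (2 * L), f' x ^ 2 := by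
    rw [hF'2, integral_indicator measurableSet_Icc]
  obtain ⟨ig, ih, vg, vh⟩ := aux_gh γ d hγ hdpos
  rw [← hg] at ig vg
  rw [← hh] at ih vh
  constructor
  · have hgeven : ∀ y, g (-y) = g y := by
      intro y
      simp [hg, transProfile]
    have hpt : ∀ s ∈ Set.Ioi (0 : ℝ), Φ (s * Real.cos (β / 2)) (s * Real.sin (β / 2)) ^ 2
        = (fun x => F x ^ 2) (s * Real.cos (β / 2)) := by
      intro s hs
      have hs : 0 < s := hs
      by_cases hx : s * Real.cos (β / 2) ∈ Set.Icc L (2 * L)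
      · have h1 : |s * Real.sin (β / 2)| ≤ 2 * d := by
          rw [abs_of_pos (by positivity)]
          have : (s * Real.sin (β / 2)) * Real.cos (β / 2) ≤ (2 * d) * Real.cos (β / 2) := by
            have := mul_le_mul_of_nonneg_right hx.2 hsn.le
            linarith
          exact le_of_mul_le_mul_right this hc
        simp only [hΦ, hg, transProfile]
        rw [if_pos h1, mul_one]
      · simp [hΦ, hF, hx]
    have hsub : Set.Ioi (0 : ℝ) ∩ Set.Icc L (2 * L) = Set.Icc L (2 * L) :=
      Set.inter_eq_right.2 (fun x hx => lt_of_lt_of_le hL hx.1)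
    have key : ∫ s in Set.Ioi (0 : ℝ), Φ (s * Real.cos (β / 2)) (s * Real.sin (β / 2)) ^ 2
        = (Real.cos (β / 2))⁻¹ * ∫ x in Set.Icc L (2 * L), f x ^ 2 := by
      rw [setIntegral_congr_fun measurableSet_Ioi hpt,
        integral_comp_mul_right_Ioi (fun x => F x ^ 2) 0 hc, hF2,
        setIntegral_indicator measurableSet_Icc, zero_mul,
        hsub, smul_eq_mul]
    have e2 : ∀ s : ℝ, Φ (s * Real.cos (β / 2)) (-(s * Real.sin (β / 2))) =
        Φ (s * Real.cos (β / 2)) (s * Real.sin (β / 2)) := by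
      intro s
      simp only [hΦ, hgeven]
    simp only [e2]
    rw [key]
    ring
  · rw [Measure.volume_eq_prod, integral_add (iF'.mul_prod ig) (iF.mul_prod ih),
      integral_prod_mul (fun x => F' x ^ 2) (fun y => g y ^ 2),
      integral_prod_mul (fun x => F x ^ 2) (fun y => h y ^ 2),
      integral_prod_mul (fun x => F x ^ 2) (fun y => g y ^ 2), vF, vF', vg, vh]
    generalize (∫ x in Set.Icc L (2 * L), f x ^ 2) = B at hB ⊢
    generalize (∫ x in Set.Icc L (2 * L), f' x ^ 2) = A
    generalize (Real.cos (β / 2))⁻¹ = c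
    rw [div_lt_div_iff₀ hB (by positivity)]
    have : A * (4 * d + 1 / γ) + B * γ - 2 * γ * c * B + γ ^ 2 / 4 * (B * (4 * d + 1 / γ))
        = (A * (1 + 4 * γ * d) - γ ^ 2 * (2 * c - γ * d - 5 / 4) * B) / γ := by
      field_simp
      ring
    rw [this, div_neg_iff]
    constructor
    · rintro (h | h) <;> linarith [h.1, h.2]
    · intro h
      exact Or.inr ⟨by linarith, hγ⟩
end

section
/- Let γ > 0 and let n be a positive integer. Then there exists β₀ ∈ (0, π) such that for every β ∈ (0, β₀) there is an n-dimensional real subspace V of L²(ℝ²), consisting of compactly supported Lipschitz functions, such that every nonzero Φ ∈ V satisfies ∫_{ℝ²} |∇Φ(x)|² dx − γ·[∫₀^∞ |Φ(s·cos(β/2), s·sin(β/2))|² ds + ∫₀^∞ |Φ(s·cos(β/2), −s·sin(β/2))|² ds] + (γ²/4)·∫_{ℝ²} |Φ(x)|² dx < 0, where ∇Φ denotes the almost-everywhere defined gradient of the Lipschitz function Φ. (This is the quadratic-form statement that for any fixed n, the broken-line leaky graph Hamiltonian H₂(β) with sufficiently small opening angle β has at least n eigenvalues below the essential-spectrum threshold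 −γ²/4.) -/
open MeasureTheory Real

/-- The point `(a, b)` of the Euclidean plane. -/
noncomputable def pt (a b : ℝ) : EuclideanSpace ℝ (Fin 2) :=
  (WithLp.equiv 2 (Fin 2 → ℝ)).symm ![a, b]

noncomputable def hh (t : ℝ) : ℝ := (max (1 - t ^ 2) 0) ^ 2

noncomputable def hd (t : ℝ) : ℝ := -4 * t * max (1 - t ^ 2) 0

lemma hasDerivAt_maxsq (u : ℝ) : HasDerivAt (fun u : ℝ => (max u 0) ^ 2) (2 * max u 0) u := by
  rcases lt_trichotomy u 0 with h | h | h
  · rw [max_eq_right h.le, mul_zero]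
    refine (hasDerivAt_const u (0 : ℝ)).congr_of_eventuallyEq ?_
    filter_upwards [gt_mem_nhds h] with v hv
    simp [max_eq_right hv.le]
  · subst h
    rw [max_self, mul_zero, hasDerivAt_iff_isLittleO_nhds_zero]
    simp only [zero_add, max_self, smul_zero, sub_zero]
    have h2 : (fun h : ℝ => (max h 0) ^ 2 - 0 ^ 2) =O[nhds 0] (fun h : ℝ => h ^ 2) := by
      refine Asymptotics.IsBigO.of_bound 1 (Filter.Eventually.of_forall fun x => ?_)
      rw [one_mul, norm_of_nonneg (sq_nonneg x), zero_pow two_ne_zero, sub_zero,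
        norm_of_nonneg (sq_nonneg _)]
      rcases le_total x 0 with h | h
      · simp [max_eq_right h]; positivity
      · simp [max_eq_left h]
    exact h2.trans_isLittleO (Asymptotics.isLittleO_pow_id one_lt_two)
  · rw [max_eq_left h.le]
    have := (hasDerivAt_id u).pow 2
    simp only [id, Nat.cast_ofNat, Nat.add_one_sub_one, pow_one, mul_one] at this
    refine this.congr_of_eventuallyEq ?_
    filter_upwards [lt_mem_nhds h] with v hv
    simp [max_eq_left hv.le]

lemma hasDerivAt_hh (t : ℝ) : HasDerivAt hh (hd t) t := by
  have h1 : HasDerivAt (fun t : ℝ => 1 - t ^ 2) (-(2 * t)) t := by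
    simpa using ((hasDerivAt_id t).pow 2).const_sub 1
  have := (hasDerivAt_maxsq (1 - t ^ 2)).comp t h1
  refine this.congr_deriv ?_
  unfold hd; ring

lemma cont_hd : Continuous hd := by unfold hd; fun_prop

lemma cont_hh : Continuous hh := by unfold hh; fun_prop

lemma contDiff_hh : ContDiff ℝ 1 hh := by
  rw [contDiff_one_iff_deriv]
  refine ⟨fun t => (hasDerivAt_hh t).differentiableAt, ?_⟩
  have : deriv hh = hd := funext fun t => (hasDerivAt_hh t).deriv
  rw [this]; exact cont_hd

lemma max_zero_of (t : ℝ) (ht : 1 ≤ |t|) : max (1 - t ^ 2) 0 = 0 := by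
  apply max_eq_right
  have := sq_abs t
  nlinarith

lemma hh_zero (t : ℝ) (ht : 1 ≤ |t|) : hh t = 0 := by
  unfold hh; rw [max_zero_of t ht]; norm_num

lemma hd_zero (t : ℝ) (ht : 1 ≤ |t|) : hd t = 0 := by
  unfold hd; rw [max_zero_of t ht]; norm_num

lemma int_bump (k p : ℝ → ℝ) (hk : ∀ t, 1 ≤ |t| → k t = 0)
    (hp : ∀ t, |t| ≤ 1 → k t ^ 2 = p t) : ∫ t, k t ^ 2 = ∫ t in (-1 : ℝ)..1, p t := by
  rw [intervalIntegral.integral_of_le (by norm_num)]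
  rw [← setIntegral_eq_integral_of_forall_compl_eq_zero (s := Set.Ioc (-1 : ℝ) 1)]
  · refine setIntegral_congr_fun measurableSet_Ioc fun t ht => hp t (abs_le.2 ⟨ht.1.le, ht.2⟩)
  · intro t ht
    rw [hk t]; · norm_num
    by_contra h
    push Not at h
    exact ht ⟨(abs_lt.1 h).1, (abs_lt.1 h).2.le⟩

lemma max_of_le (t : ℝ) (ht : |t| ≤ 1) : max (1 - t ^ 2) 0 = 1 - t ^ 2 := by
  apply max_eq_left
  have := sq_abs t
  nlinarith [abs_nonneg t]

lemma int_hh : ∫ t, hh t ^ 2 = 256 / 315 := by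
  rw [int_bump hh (fun t => 1 - 4 * t ^ 2 + 6 * t ^ 4 - 4 * t ^ 6 + t ^ 8) hh_zero]
  · have e : ∀ t : ℝ, HasDerivAt
        (fun t : ℝ => t - 4 / 3 * t ^ 3 + 6 / 5 * t ^ 5 - 4 / 7 * t ^ 7 + 1 / 9 * t ^ 9)
        (1 - 4 * t ^ 2 + 6 * t ^ 4 - 4 * t ^ 6 + t ^ 8) t := by
      intro t
      have := (((hasDerivAt_id t).sub (((hasDerivAt_id t).pow 3).const_mul (4 / 3))).add
        (((hasDerivAt_id t).pow 5).const_mul (6 / 5))).sub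
        (((hasDerivAt_id t).pow 7).const_mul (4 / 7)) |>.add
        (((hasDerivAt_id t).pow 9).const_mul (1 / 9))
      refine this.congr_deriv ?_
      simp; ring
    rw [intervalIntegral.integral_eq_sub_of_hasDerivAt (fun t _ => e t)
      (Continuous.intervalIntegrable (by fun_prop) _ _)]
    norm_num
  · intro t ht
    unfold hh; rw [max_of_le t ht]; ring

lemma int_hd : ∫ t, hd t ^ 2 = 256 / 105 := by
  rw [int_bump hd (fun t => 16 * t ^ 2 - 32 * t ^ 4 + 16 * t ^ 6) hd_zero]
  · have e : ∀ t : ℝ, HasDerivAt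
        (fun t : ℝ => 16 / 3 * t ^ 3 - 32 / 5 * t ^ 5 + 16 / 7 * t ^ 7)
        (16 * t ^ 2 - 32 * t ^ 4 + 16 * t ^ 6) t := by
      intro t
      have := ((((hasDerivAt_id t).pow 3).const_mul (16 / 3)).sub
        (((hasDerivAt_id t).pow 5).const_mul (32 / 5))).add
        (((hasDerivAt_id t).pow 7).const_mul (16 / 7))
      refine this.congr_deriv ?_
      simp; ring
    rw [intervalIntegral.integral_eq_sub_of_hasDerivAt (fun t _ => e t)
      (Continuous.intervalIntegrable (by fun_prop) _ _)]
    norm_num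
  · intro t ht
    unfold hd; rw [max_of_le t ht]; ring

lemma cs_bump (k : ℝ → ℝ) (hk : ∀ t, 1 ≤ |t| → k t = 0) : HasCompactSupport k := by
  refine HasCompactSupport.intro (isCompact_Icc (a := (-1 : ℝ)) (b := 1)) fun t ht => hk t ?_
  by_contra h
  push Not at h
  exact ht ⟨(abs_lt.1 h).1.le, (abs_lt.1 h).2.le⟩

lemma integrable_bump (k : ℝ → ℝ) (hc : Continuous k) (hk : ∀ t, 1 ≤ |t| → k t = 0) :
    Integrable (fun t => k t ^ 2) := by
  refine Continuous.integrable_of_hasCompactSupport (by fun_prop)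
    (cs_bump _ fun t ht => by simp [hk t ht])

/-- combination of translated scaled bumps -/
noncomputable def comb (k : ℝ → ℝ) (M : ℝ) {n : ℕ} (c : Fin n → ℝ) (x : ℝ) : ℝ :=
  ∑ i, c i * k (x / M - (2 * (i : ℝ) + 1))

lemma bump_disj (k : ℝ → ℝ) (hk : ∀ t, 1 ≤ |t| → k t = 0) (t : ℝ) {n : ℕ} (i j : Fin n)
    (hij : i ≠ j) : k (t - (2 * (i : ℝ) + 1)) * k (t - (2 * (j : ℝ) + 1)) = 0 := by
  by_contra h
  have h1 := left_ne_zero_of_mul h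
  have h2 := right_ne_zero_of_mul h
  have a1 : |t - (2 * (i : ℝ) + 1)| < 1 := by
    by_contra h'; exact h1 (hk _ (not_lt.1 h'))
  have a2 : |t - (2 * (j : ℝ) + 1)| < 1 := by
    by_contra h'; exact h2 (hk _ (not_lt.1 h'))
  rw [abs_lt] at a1 a2
  have b1 : ((i : ℕ) : ℝ) < (j : ℕ) + 1 := by linarith
  have b2 : ((j : ℕ) : ℝ) < (i : ℕ) + 1 := by linarith
  have b1' : (i : ℕ) < (j : ℕ) + 1 := by exact_mod_cast b1
  have b2' : (j : ℕ) < (i : ℕ) + 1 := by exact_mod_cast b2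
  exact hij (Fin.ext (by omega))

lemma comb_sq (k : ℝ → ℝ) (hk : ∀ t, 1 ≤ |t| → k t = 0) (M : ℝ) {n : ℕ} (c : Fin n → ℝ) (x : ℝ) :
    comb k M c x ^ 2 = ∑ i, c i ^ 2 * k (x / M - (2 * (i : ℝ) + 1)) ^ 2 := by
  unfold comb
  rw [sq, Finset.sum_mul_sum]
  refine Finset.sum_congr rfl fun i _ => ?_
  rw [Finset.sum_eq_single i]
  · ring
  · intro j _ hj
    have := bump_disj k hk (x / M) i j hj.symm
    linear_combination (c i * c j) * this
  · simp

lemma scaled_integrable (k : ℝ → ℝ) (hc : Continuous k) (hk : ∀ t, 1 ≤ |t| → k t = 0)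
    (M : ℝ) (hM : 0 < M) (a : ℝ) :
    Integrable (fun x => k (x / M - a) ^ 2) := by
  have h1 := (integrable_bump k hc hk).comp_sub_right a
  exact h1.comp_div hM.ne'

lemma scaled_integral (k : ℝ → ℝ) (M : ℝ) (hM : 0 < M) (a : ℝ) :
    ∫ x, k (x / M - a) ^ 2 = M * ∫ t, k t ^ 2 := by
  have := Measure.integral_comp_div (fun y => k (y - a) ^ 2) M
  rw [this, integral_sub_right_eq_self (fun y => k y ^ 2) a, abs_of_pos hM, smul_eq_mul]

lemma comb_integrable (k : ℝ → ℝ) (hc : Continuous k) (hk : ∀ t, 1 ≤ |t| → k t = 0)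
    (M : ℝ) (hM : 0 < M) {n : ℕ} (c : Fin n → ℝ) :
    Integrable (fun x => comb k M c x ^ 2) := by
  simp_rw [comb_sq k hk]
  exact integrable_finsetSum _ fun i _ => (scaled_integrable k hc hk M hM _).const_mul _

lemma comb_integral (k : ℝ → ℝ) (hc : Continuous k) (hk : ∀ t, 1 ≤ |t| → k t = 0)
    (M : ℝ) (hM : 0 < M) {n : ℕ} (c : Fin n → ℝ) :
    ∫ x, comb k M c x ^ 2 = M * (∫ t, k t ^ 2) * ∑ i, c i ^ 2 := by
  simp_rw [comb_sq k hk]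
  rw [integral_finsetSum _ fun i _ => (scaled_integrable k hc hk M hM _).const_mul _]
  simp_rw [integral_const_mul, scaled_integral k M hM]
  rw [← Finset.sum_mul]; ring

lemma comb_zero (k : ℝ → ℝ) (hk : ∀ t, 1 ≤ |t| → k t = 0)
    (M : ℝ) (hM : 0 < M) {n : ℕ} (c : Fin n → ℝ) (x : ℝ) (hx : x ≤ 0 ∨ 2 * n * M ≤ x) :
    comb k M c x = 0 := by
  unfold comb
  refine Finset.sum_eq_zero fun i _ => ?_
  rw [hk, mul_zero]
  have hi : ((i : ℕ) : ℝ) + 1 ≤ n := by exact_mod_cast i.2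
  have hi0 : (0 : ℝ) ≤ ((i : ℕ) : ℝ) := by positivity
  rw [le_abs]
  rcases hx with hx | hx
  · right
    have : x / M ≤ 0 := div_nonpos_of_nonpos_of_nonneg hx hM.le
    linarith
  · left
    have : 2 * (n : ℝ) ≤ x / M := (le_div_iff₀ hM).2 hx
    linarith

lemma comb_hasDerivAt (M : ℝ) {n : ℕ} (c : Fin n → ℝ) (x : ℝ) :
    HasDerivAt (comb hh M c) (comb hd M c x / M) x := by
  unfold comb
  rw [Finset.sum_div]
  refine HasDerivAt.fun_sum fun i _ => ?_
  have h1 : HasDerivAt (fun x : ℝ => x / M - (2 * (i : ℝ) + 1)) (1 / M) x :=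
    ((hasDerivAt_id x).div_const M).sub_const _
  refine (((hasDerivAt_hh _).comp x h1).const_mul (c i)).congr_deriv ?_
  ring

lemma comb_contDiff (M : ℝ) {n : ℕ} (c : Fin n → ℝ) : ContDiff ℝ 1 (comb hh M c) := by
  unfold comb
  refine ContDiff.sum fun i _ => contDiff_const.mul (contDiff_hh.comp ?_)
  exact (contDiff_id.div_const M).sub contDiff_const

lemma prod_mp : MeasurePreserving (fun x : EuclideanSpace ℝ (Fin 2) => (x 0, x 1)) :=
  (volume_preserving_finTwoArrow ℝ).comp (EuclideanSpace.volume_preserving_symm_measurableEquiv_toLp (Fin 2)) 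

lemma prod_emb : MeasurableEmbedding (fun x : EuclideanSpace ℝ (Fin 2) => (x 0, x 1)) :=
  ((MeasurableEquiv.toLp 2 (Fin 2 → ℝ)).symm.trans
    (MeasurableEquiv.finTwoArrow (α := ℝ))).measurableEmbedding

lemma int_prod (G H : ℝ → ℝ) :
    ∫ x : EuclideanSpace ℝ (Fin 2), G (x 0) * H (x 1) = (∫ x, G x) * ∫ y, H y := by
  rw [← integral_prod_mul]
  exact prod_mp.integral_comp prod_emb (fun z : ℝ × ℝ => G z.1 * H z.2)

lemma integrable_prod' (G H : ℝ → ℝ) (hG : Integrable G) (hH : Integrable H) :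
    Integrable (fun x : EuclideanSpace ℝ (Fin 2) => G (x 0) * H (x 1)) :=
  (prod_mp.integrable_comp_emb prod_emb).2 (hG.mul_prod hH)

lemma fderiv_norm (F G F' G' : ℝ → ℝ) (hF : ∀ x, HasDerivAt F (F' x) x)
    (hG : ∀ x, HasDerivAt G (G' x) x) (x : EuclideanSpace ℝ (Fin 2)) :
    ‖fderiv ℝ (fun x : EuclideanSpace ℝ (Fin 2) => F (x 0) * G (x 1)) x‖ ^ 2
      = F' (x 0) ^ 2 * G (x 1) ^ 2 + F (x 0) ^ 2 * G' (x 1) ^ 2 := by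
  have p (i : Fin 2) : HasFDerivAt (fun x : EuclideanSpace ℝ (Fin 2) => x i)
      (EuclideanSpace.proj i : EuclideanSpace ℝ (Fin 2) →L[ℝ] ℝ) x :=
    (EuclideanSpace.proj i : EuclideanSpace ℝ (Fin 2) →L[ℝ] ℝ).hasFDerivAt
  have h1 := (hF (x 0)).comp_hasFDerivAt x (p 0)
  have h2 := (hG (x 1)).comp_hasFDerivAt x (p 1)
  have h3 := h1.mul h2
  have e : fderiv ℝ (fun x : EuclideanSpace ℝ (Fin 2) => F (x 0) * G (x 1)) x
      = innerSL ℝ (!₂[F' (x 0) * G (x 1), F (x 0) * G' (x 1)] : EuclideanSpace ℝ (Fin 2)) := by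
    refine Eq.trans h3.fderiv ?_
    ext v
    simp [PiLp.inner_apply, Fin.sum_univ_two]
    ring
  rw [e, innerSL_apply_norm, EuclideanSpace.norm_sq_eq]
  simp [Fin.sum_univ_two]
  ring

lemma cont_pt : Continuous (fun p : ℝ × ℝ => pt p.1 p.2) := by
  unfold pt
  refine (PiLp.continuous_toLp 2 _).comp ?_
  refine continuous_pi fun i => ?_
  fin_cases i
  · exact continuous_fst
  · exact continuous_snd

lemma pt_zero (a b : ℝ) : pt a b 0 = a := rfl
lemma pt_one (a b : ℝ) : pt a b 1 = b := rfl

noncomputable def Phi (L M : ℝ) (n : ℕ) : (Fin n → ℝ) →ₗ[ℝ] (EuclideanSpace ℝ (Fin 2) → ℝ) where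
  toFun c x := comb hh M c (x 0) * hh (x 1 / L)
  map_add' c d := by
    funext x
    simp only [comb, Pi.add_apply, add_mul, Finset.sum_add_distrib]
  map_smul' r c := by
    funext x
    simp only [comb, Pi.smul_apply, smul_eq_mul, RingHom.id_apply, mul_assoc, Finset.mul_sum]
    rw [← mul_assoc, Finset.mul_sum]

lemma hh_0 : hh 0 = 1 := by unfold hh; norm_num

lemma Phi_inj (L M : ℝ) (hM : 0 < M) (n : ℕ) : Function.Injective (Phi L M n) := by
  rw [← LinearMap.ker_eq_bot, LinearMap.ker_eq_bot']
  intro c hc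
  funext i
  have := congrFun hc (pt (M * (2 * (i : ℝ) + 1)) 0)
  simp only [Phi, LinearMap.coe_mk, AddHom.coe_mk, pt_zero, pt_one, zero_div, hh_0, mul_one,
    Pi.zero_apply] at this
  unfold comb at this
  rw [Finset.sum_eq_single i] at this
  · rw [mul_div_cancel_left₀ _ hM.ne', sub_self, hh_0, mul_one] at this
    exact this
  · intro j _ hj
    rw [mul_div_cancel_left₀ _ hM.ne']
    have := bump_disj hh hh_zero (2 * (i : ℝ) + 1) i j hj.symm
    rw [sub_self, hh_0, one_mul] at this
    rw [this, mul_zero]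
  · simp

lemma Phi_cs (L M : ℝ) (hL : 0 < L) (hM : 0 < M) (n : ℕ) (c : Fin n → ℝ) :
    HasCompactSupport (Phi L M n c) := by
  refine HasCompactSupport.intro (K := (fun p : ℝ × ℝ => pt p.1 p.2) ''
    (Set.Icc 0 (2 * n * M) ×ˢ Set.Icc (-L) L))
    ((isCompact_Icc.prod isCompact_Icc).image cont_pt) ?_
  intro x hx
  by_contra h
  apply hx
  refine ⟨(x 0, x 1), ⟨?_, ?_⟩, ?_⟩
  · by_contra h'
    apply h
    show comb hh M c (x 0) * hh (x 1 / L) = 0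
    rw [comb_zero hh hh_zero M hM, zero_mul]
    rw [Set.mem_Icc, not_and_or, not_le, not_le] at h'
    exact h'.imp le_of_lt le_of_lt
  · by_contra h'
    apply h
    show comb hh M c (x 0) * hh (x 1 / L) = 0
    rw [hh_zero, mul_zero]
    rw [abs_div, abs_of_pos hL, le_div_iff₀ hL, one_mul]
    by_contra h2
    push Not at h2
    rw [abs_lt] at h2
    exact h' ⟨h2.1.le, h2.2.le⟩
  · ext i; fin_cases i <;> rfl

lemma Phi_lip (L M : ℝ) (hL : 0 < L) (hM : 0 < M) (n : ℕ) (c : Fin n → ℝ) :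
    ∃ K : NNReal, LipschitzWith K (Phi L M n c) := by
  have : ContDiff ℝ 1 (Phi L M n c) := by
    show ContDiff ℝ 1 (fun x : EuclideanSpace ℝ (Fin 2) => comb hh M c (x 0) * hh (x 1 / L))
    have p (i : Fin 2) : ContDiff ℝ 1 (fun x : EuclideanSpace ℝ (Fin 2) => x i) :=
      (EuclideanSpace.proj i : EuclideanSpace ℝ (Fin 2) →L[ℝ] ℝ).contDiff
    exact ((comb_contDiff M c).comp (p 0)).mul (contDiff_hh.comp ((p 1).div_const L))
  exact ContDiff.lipschitzWith_of_hasCompactSupport (Phi_cs L M hL hM n c) this one_ne_zero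

lemma Phi_grad (L M : ℝ) (hL : 0 < L) (hM : 0 < M) (n : ℕ) (c : Fin n → ℝ) :
    ∫ x, ‖fderiv ℝ (Phi L M n c) x‖ ^ 2
      = (L / M + M / L) * (256 / 105 * (256 / 315)) * ∑ i, c i ^ 2 := by
  have hG (y : ℝ) : HasDerivAt (fun y => hh (y / L)) (hd (y / L) / L) y := by
    have h1 : HasDerivAt (fun y : ℝ => y / L) (1 / L) y := (hasDerivAt_id y).div_const L
    refine ((hasDerivAt_hh _).comp y h1).congr_deriv ?_
    ring
  have key (x) : ‖fderiv ℝ (Phi L M n c) x‖ ^ 2 = _ :=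
    fderiv_norm (comb hh M c) (fun y => hh (y / L)) (fun x => comb hd M c x / M)
      (fun y => hd (y / L) / L) (comb_hasDerivAt M c) hG x
  simp_rw [key]
  have s1 := scaled_integrable hh cont_hh hh_zero L hL 0
  have s2 := scaled_integrable hd cont_hd hd_zero L hL 0
  have t1 := scaled_integral hh L hL 0
  have t2 := scaled_integral hd L hL 0
  simp only [sub_zero] at s1 s2 t1 t2
  simp_rw [div_pow]
  rw [integral_add, int_prod (fun x => comb hd M c x ^ 2 / M ^ 2) (fun y => hh (y / L) ^ 2),
    int_prod (fun x => comb hh M c x ^ 2) (fun y => hd (y / L) ^ 2 / L ^ 2),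
    integral_div, integral_div, t1, t2, comb_integral hh cont_hh hh_zero M hM,
    comb_integral hd cont_hd hd_zero M hM, int_hh, int_hd]
  · field_simp
  · exact integrable_prod' (fun x => comb hd M c x ^ 2 / M ^ 2) (fun y => hh (y / L) ^ 2)
      ((comb_integrable hd cont_hd hd_zero M hM c).div_const _) s1
  · exact integrable_prod' (fun x => comb hh M c x ^ 2) (fun y => hd (y / L) ^ 2 / L ^ 2)
      (comb_integrable hh cont_hh hh_zero M hM c) (s2.div_const _)

lemma Phi_sq (L M : ℝ) (hL : 0 < L) (hM : 0 < M) (n : ℕ) (c : Fin n → ℝ) :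
    ∫ x, (Phi L M n c) x ^ 2 = L * M * (256 / 315) ^ 2 * ∑ i, c i ^ 2 := by
  have key (x) : (Phi L M n c) x ^ 2 = comb hh M c (x 0) ^ 2 * hh (x 1 / L) ^ 2 := mul_pow _ _ _
  simp_rw [key]
  have t1 := scaled_integral hh L hL 0
  simp only [sub_zero] at t1
  rw [int_prod (fun x => comb hh M c x ^ 2) (fun y => hh (y / L) ^ 2), t1,
    comb_integral hh cont_hh hh_zero M hM, int_hh]
  ring

lemma hh_lower (t : ℝ) (ht : |t| ≤ 1 / 10) : 9 / 10 ≤ hh t ^ 2 := by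
  have h1 : (99 / 100 : ℝ) ≤ max (1 - t ^ 2) 0 := by
    apply le_max_of_le_left
    have := sq_abs t
    nlinarith [abs_nonneg t]
  unfold hh
  calc (9 / 10 : ℝ) ≤ ((99 / 100) ^ 2) ^ 2 := by norm_num
    _ ≤ _ := by gcongr

lemma hh_le_one (t : ℝ) : hh t ^ 2 ≤ 1 := by
  have h1 : max (1 - t ^ 2) 0 ≤ 1 := max_le (by nlinarith [sq_nonneg t]) zero_le_one
  have h0 : 0 ≤ max (1 - t ^ 2) 0 := le_max_right _ _
  unfold hh
  exact pow_le_one₀ (by positivity) (pow_le_one₀ h0 h1)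

lemma Phi_line (L M : ℝ) (hL : 0 < L) (hM : 0 < M) (n : ℕ) (c : Fin n → ℝ) (C S : ℝ)
    (hC : 0 < C) (hC1 : C ≤ 1) (hS : 2 * n * M * |S| ≤ C * (L / 10)) :
    9 / 10 * (M * (256 / 315) * ∑ i, c i ^ 2) ≤
      ∫ s in Set.Ioi (0 : ℝ), (Phi L M n c) (pt (s * C) (s * S)) ^ 2 := by
  have key (s : ℝ) : (Phi L M n c) (pt (s * C) (s * S)) ^ 2
      = comb hh M c (s * C) ^ 2 * hh (s * S / L) ^ 2 := mul_pow _ _ _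
  simp_rw [key]
  have z (s : ℝ) (hs : s ≤ 0 ∨ 2 * n * M ≤ s * C) : comb hh M c (s * C) = 0 :=
    comb_zero hh hh_zero M hM c _ (hs.imp (fun h => mul_nonpos_of_nonpos_of_nonneg h hC.le) id)
  rw [setIntegral_eq_integral_of_forall_compl_eq_zero]
  swap
  · intro s hs
    rw [z s (Or.inl (by simpa using hs))]; norm_num
  have hi : Integrable (fun s : ℝ => comb hh M c (s * C) ^ 2) :=
    (comb_integrable hh cont_hh hh_zero M hM c).comp_mul_right' hC.ne'
  have hv : ∫ s : ℝ, comb hh M c (s * C) ^ 2 = C⁻¹ * (M * (256 / 315) * ∑ i, c i ^ 2) := by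
    have := Measure.integral_comp_mul_right (fun x => comb hh M c x ^ 2) C
    rw [this, comb_integral hh cont_hh hh_zero M hM, int_hh, abs_of_pos (by positivity),
      smul_eq_mul]
  have h1 : 9 / 10 * (M * (256 / 315) * ∑ i, c i ^ 2) ≤
      ∫ s : ℝ, 9 / 10 * comb hh M c (s * C) ^ 2 := by
    rw [integral_const_mul, hv]
    have : 1 ≤ C⁻¹ := (one_le_inv₀ hC).2 hC1
    have h0 : 0 ≤ M * (256 / 315) * ∑ i, c i ^ 2 := by positivity
    nlinarith
  refine h1.trans (integral_mono (hi.const_mul _) ?_ fun s => ?_)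
  · refine hi.mono' ?_ (Filter.Eventually.of_forall fun s => ?_)
    · have := (comb_contDiff M c).continuous
      have := cont_hh
      exact Continuous.aestronglyMeasurable (by fun_prop)
    · rw [norm_of_nonneg (by positivity)]
      exact mul_le_of_le_one_right (by positivity) (hh_le_one _)
  · show 9 / 10 * comb hh M c (s * C) ^ 2 ≤ comb hh M c (s * C) ^ 2 * hh (s * S / L) ^ 2
    by_cases hs : s ≤ 0 ∨ 2 * n * M ≤ s * C
    · rw [z s hs]; norm_num
    · push Not at hs
      rw [mul_comm]
      refine mul_le_mul_of_nonneg_left (hh_lower _ ?_) (by positivity)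
      rw [abs_div, abs_of_pos hL, div_le_iff₀ hL, abs_mul, abs_of_pos hs.1]
      have h2 : s * C * |S| ≤ 2 * n * M * |S| := mul_le_mul_of_nonneg_right hs.2.le (abs_nonneg _)
      have h3 : C * (s * |S|) ≤ C * (L / 10) := by linarith
      have := le_of_mul_le_mul_left h3 hC
      linarith

/-- for `γ > 0` and any positive integer `n` there is `β₀ ∈ (0, π)` such that for
every opening angle `β ∈ (0, β₀)` there is an `n`-dimensional subspace of compactly supported
Lipschitz functions on which the quadratic form of `H₂(β)` shifted by `γ²/4` is negative: hence
`H₂(β)` has at least `n` eigenvalues below `−γ²/4`. -/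
theorem brokenLine_many_bound_states
    (γ : ℝ) (hγ : 0 < γ) (n : ℕ) (hn : 0 < n) :
    ∃ β₀ : ℝ, 0 < β₀ ∧ β₀ < Real.pi ∧
      ∀ β : ℝ, 0 < β → β < β₀ →
        ∃ V : Submodule ℝ (EuclideanSpace ℝ (Fin 2) → ℝ),
          Module.finrank ℝ V = n ∧
          (∀ Φ ∈ V, HasCompactSupport Φ ∧ ∃ K : NNReal, LipschitzWith K Φ) ∧
          (∀ Φ ∈ V, Φ ≠ 0 →
            (∫ x, ‖fderiv ℝ Φ x‖ ^ 2) -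
                γ * ((∫ s in Set.Ioi (0 : ℝ),
                        Φ (pt (s * Real.cos (β / 2)) (s * Real.sin (β / 2))) ^ 2) +
                      (∫ s in Set.Ioi (0 : ℝ),
                        Φ (pt (s * Real.cos (β / 2)) (-(s * Real.sin (β / 2)))) ^ 2)) +
                γ ^ 2 / 4 * ∫ x, Φ x ^ 2 < 0) := by
  have hnR : (1 : ℝ) ≤ n := by exact_mod_cast hn
  refine ⟨1 / (40 * n), by positivity, ?_, ?_⟩
  · have : 1 / (40 * (n : ℝ)) ≤ 1 := by
      rw [div_le_one (by positivity)]; linarith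
    linarith [Real.pi_gt_three]
  intro β hβ hβ1
  rw [lt_div_iff₀ (by positivity)] at hβ1
  have hβ2 : β ≤ 1 := by nlinarith
  have hC : 1 / 2 ≤ Real.cos (β / 2) := by
    have := Real.one_sub_sq_div_two_le_cos (x := β / 2)
    nlinarith
  have hS0 : 0 ≤ Real.sin (β / 2) :=
    Real.sin_nonneg_of_nonneg_of_le_pi (by linarith) (by linarith [Real.pi_gt_three])
  have hS1 : Real.sin (β / 2) ≤ β / 2 := Real.sin_le (by linarith)
  obtain ⟨L, hLdef⟩ : ∃ L, L = 3 / γ := ⟨_, rfl⟩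
  have hL : 0 < L := by rw [hLdef]; positivity
  have hM : 0 < 2 * L := by positivity
  have hcond : 2 * n * (2 * L) * |Real.sin (β / 2)| ≤ Real.cos (β / 2) * (L / 10) := by
    rw [abs_of_nonneg hS0]
    have h1 : 4 * n * Real.sin (β / 2) ≤ 1 / 20 := by nlinarith
    have h2 : 4 * n * Real.sin (β / 2) ≤ Real.cos (β / 2) / 10 := by linarith
    nlinarith
  refine ⟨LinearMap.range (Phi L (2 * L) n), ?_, ?_, ?_⟩
  · rw [LinearMap.finrank_range_of_inj (Phi_inj L (2 * L) hM n)]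
    simp
  · rintro _ ⟨c, rfl⟩
    exact ⟨Phi_cs L _ hL hM n c, Phi_lip L _ hL hM n c⟩
  · rintro _ ⟨c, rfl⟩ hne
    have hc : c ≠ 0 := by
      rintro rfl; exact hne (map_zero _)
    have hpos : 0 < ∑ i, c i ^ 2 := by
      obtain ⟨i, hi⟩ := Function.ne_iff.1 hc
      refine Finset.sum_pos' (fun i _ => sq_nonneg _) ⟨i, Finset.mem_univ _, ?_⟩
      have : c i ≠ 0 := hi
      positivity
    have l1 := Phi_line L _ hL hM n c _ _ (by linarith) (Real.cos_le_one _) hcond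
    have l2 := Phi_line L _ hL hM n c (Real.cos (β / 2)) (-Real.sin (β / 2)) (by linarith)
      (Real.cos_le_one _) (by rwa [abs_neg])
    simp_rw [mul_neg] at l2
    rw [Phi_grad L _ hL hM, Phi_sq L _ hL hM]
    have e1 : L / (2 * L) = 1 / 2 := by field_simp
    have e2 : 2 * L / L = 2 := by field_simp
    rw [e1, e2]
    have e3 : γ * L = 3 := by rw [hLdef]; field_simp
    have l3 := mul_le_mul_of_nonneg_left (add_le_add l1 l2) hγ.le
    have e4 : γ * (9 / 10 * (2 * L * (256 / 315) * ∑ i, c i ^ 2) +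
        9 / 10 * (2 * L * (256 / 315) * ∑ i, c i ^ 2))
        = 3 * (36 / 10 * (256 / 315)) * ∑ i, c i ^ 2 := by
      rw [← e3]; ring
    have e5 : γ ^ 2 / 4 * (L * (2 * L) * (256 / 315) ^ 2 * ∑ i, c i ^ 2)
        = 9 / 2 * (256 / 315) ^ 2 * ∑ i, c i ^ 2 := by
      have : γ ^ 2 * L ^ 2 = 9 := by rw [← mul_pow, e3]; norm_num
      linear_combination (1 / 2 * (256 / 315) ^ 2 * ∑ i, c i ^ 2) * this
    rw [e4] at l3
    rw [e5]
    nlinarith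
end
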